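/- Let f_1,…,f_s ∈ R = k[x_0,…,x_n] be homogeneous polynomials and 1 ≤ c ≤ min(n,s), and assume either (1) f_1,…,f_s is an R-regular sequence, or (2) every subset of at most c+1 of the f_i is an R-regular sequence and all the f_i have the same degree. Then the resurgence of the hypersurface configuration ideal I_{V_{λ,c}} = ⋂_{1≤i_1<⋯<i_c≤s} (f_{i_1},…,f_{i_c}) is ρ(I_{V_{λ,c}}) = c·(s−c+1)/s. -/

import Mathlib

/- ------------------------------------------------------------------
   Common definitions
------------------------------------------------------------------ -/

open MvPolynomial CategoryTheory

noncomputable section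

/-- The height of an ideal: the infimum of the heights of the prime ideals containing it. -/
noncomputable def idealHeight {A : Type*} [CommRing A] (I : Ideal A) : ℕ∞ :=
  ⨅ P ∈ {P : PrimeSpectrum A | I ≤ P.asIdeal}, Order.height P

/-- The depth of a module `M` with respect to an ideal `J`: the supremum of the lengths of
`M`-regular sequences consisting of elements of `J`. -/
noncomputable def idealDepth {A : Type*} [CommRing A] (J : Ideal A)
    (M : Type*) [AddCommGroup M] [Module A M] : ℕ∞ :=
  sSup {n : ℕ∞ | ∃ rs : List A, (rs.length : ℕ∞) = n ∧ (∀ r ∈ rs, r ∈ J) ∧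
    RingTheory.Sequence.IsRegular M rs}

/-- The irrelevant maximal ideal `(x_i : i ∈ σ)` of the polynomial ring `k[x_i : i ∈ σ]`. -/
def irrelevantIdeal (k : Type) [Field k] (σ : Type) : Ideal (MvPolynomial σ k) :=
  Ideal.span (Set.range (X : σ → MvPolynomial σ k))

/-- The quotient of a polynomial ring by an ideal `I` is Cohen–Macaulay if its depth with
respect to the irrelevant maximal ideal equals its Krull dimension. -/
def IsCMQuotient {k : Type} [Field k] {σ : Type} (I : Ideal (MvPolynomial σ k)) : Prop :=
  (idealDepth (irrelevantIdeal k σ) (MvPolynomial σ k ⧸ I) : WithBot ℕ∞)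
    = ringKrullDim (MvPolynomial σ k ⧸ I)

/-- An ideal of a polynomial ring is homogeneous if it contains all homogeneous components
of each of its elements. -/
def IsHomogeneousIdeal {k : Type} [Field k] {σ : Type} (I : Ideal (MvPolynomial σ k)) : Prop :=
  ∀ p ∈ I, ∀ i : ℕ, homogeneousComponent i p ∈ I

/-- The Hilbert function of `R/I`, `t ↦ dim_k [R/I]_t`, as a function `ℤ → ℤ`
(equal to `0` in negative degrees). -/
noncomputable def hilbertFn (k : Type) [Field k] {σ : Type} (I : Ideal (MvPolynomial σ k))
    (t : ℤ) : ℤ :=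
  if t < 0 then 0
  else
    (Module.finrank k (homogeneousSubmodule σ k t.toNat) : ℤ) -
    (Module.finrank k
      ((Submodule.restrictScalars k (I : Submodule (MvPolynomial σ k) (MvPolynomial σ k))) ⊓
        homogeneousSubmodule σ k t.toNat : Submodule k (MvPolynomial σ k)) : ℤ)

/-- `P` is the Hilbert polynomial of `R/I` if it agrees with the Hilbert function of `R/I`
in all sufficiently large degrees. -/
def IsHilbertPolyOf (k : Type) [Field k] {σ : Type} (I : Ideal (MvPolynomial σ k))
    (P : Polynomial ℚ) : Prop :=
  ∃ N : ℤ, ∀ t : ℤ, N ≤ t → (hilbertFn k I t : ℚ) = P.eval (t : ℚ)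

open Classical in
/-- The Hilbert polynomial of `R/I` (defined as `0` if none exists). -/
noncomputable def hilbertPoly (k : Type) [Field k] {σ : Type} (I : Ideal (MvPolynomial σ k)) :
    Polynomial ℚ :=
  if h : ∃ P : Polynomial ℚ, IsHilbertPolyOf k I P then h.choose else 0

/-- The multiplicity (degree) `e(R/I)`: `(δ-1)!` times the leading coefficient of the Hilbert
polynomial of `R/I`, whose degree is `δ - 1` where `δ = dim R/I ≥ 1`. -/
noncomputable def multiplicityDeg (k : Type) [Field k] {σ : Type}
    (I : Ideal (MvPolynomial σ k)) : ℚ :=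
  (Nat.factorial (hilbertPoly k I).natDegree) * (hilbertPoly k I).leadingCoeff

/-- The `m`-th symbolic power of an ideal `J`:
`J^{(m)} = ⋂_{P ∈ Ass(A/J)} (J^m A_P ∩ A)`. -/
noncomputable def symbolicPower {A : Type*} [CommRing A] (J : Ideal A) (m : ℕ) : Ideal A :=
  sInf { K : Ideal A | ∃ (P : Ideal A) (hP : IsAssociatedPrime P (A ⧸ J)),
    K = Ideal.comap (algebraMap A (Localization (@Ideal.primeCompl A _ P hP.1)))
          (Ideal.map (algebraMap A (Localization (@Ideal.primeCompl A _ P hP.1))) (J ^ m)) }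

/-- `α(I)`: the least degree of a nonzero form in `I`. -/
noncomputable def alphaDeg (k : Type) [Field k] {σ : Type} (I : Ideal (MvPolynomial σ k)) : ℕ :=
  sInf {d : ℕ | ∃ p ∈ I, p ≠ 0 ∧ MvPolynomial.IsHomogeneous p d}

/-- `dim_k Tor_i^A(M, N)`, the rank over the base field `k` of the Tor module. -/
noncomputable def torRank (k : Type) [Field k] (A : Type) [CommRing A] [Algebra k A]
    (M N : Type) [AddCommGroup M] [Module A M] [AddCommGroup N] [Module A N] (i : ℕ) :
    Cardinal :=
  Module.rank k (RestrictScalars k A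
    (((Tor (ModuleCat A) i).obj (ModuleCat.of A M)).obj (ModuleCat.of A N)))

/-- The `i`-th total Betti number `dim_k Tor_i(S/I, k)` of `S/I`, where
`k = S/(x_i : i ∈ σ)`. -/
noncomputable def bettiNum (k : Type) [Field k] {σ : Type} (I : Ideal (MvPolynomial σ k))
    (i : ℕ) : Cardinal :=
  torRank k (MvPolynomial σ k) (MvPolynomial σ k ⧸ I)
    (MvPolynomial σ k ⧸ irrelevantIdeal k σ) i

/-- The first map `I_S → I_C ⊕ I_S`, `g ↦ (g, f·g)`, of the basic double linkage sequence. -/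
def bdlFirstMap {A : Type*} [CommRing A] {I_S I_C : Ideal A} (h : I_S ≤ I_C) (f : A) :
    I_S →ₗ[A] I_C × I_S :=
  LinearMap.prod (Submodule.inclusion h) (f • LinearMap.id)

/-- The second map `I_C ⊕ I_S → f·I_C + I_S`, `(a, b) ↦ f·a - b`, of the basic double
linkage sequence. -/
def bdlSecondMap {A : Type*} [CommRing A] (I_C I_S : Ideal A) (f : A) :
    I_C × I_S →ₗ[A] ↥(Ideal.span {f} * I_C + I_S) :=
  LinearMap.coprod
    (LinearMap.codRestrict ((Ideal.span {f} * I_C + I_S : Ideal A) : Submodule A A)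
      (f • (Submodule.subtype (I_C : Submodule A A)))
      (fun c => Submodule.mem_sup_left
        (Ideal.mul_mem_mul (Ideal.mem_span_singleton_self f) c.2)))
    (- LinearMap.codRestrict ((Ideal.span {f} * I_C + I_S : Ideal A) : Submodule A A)
      (Submodule.subtype (I_S : Submodule A A))
      (fun c => Submodule.mem_sup_right c.2))

/-- The ideal `I_{V_{λ,c}}` of the codimension-`c` configuration determined by `f_1, …, f_s`:
the intersection of the ideals `(f_{i_1}, …, f_{i_c})` over all `c`-subsets. -/
def configIdeal {A : Type*} [CommRing A] {s : ℕ} (c : ℕ) (f : Fin s → A) : Ideal A :=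
  ⨅ T ∈ {T : Finset (Fin s) | T.card = c}, Ideal.span (f '' ↑T)

/-- Every sublist of at most `m` of the elements `f 1, …, f s` (in any order, without
repetitions) is a regular sequence. -/
def SubsetsRegular {A : Type*} [CommRing A] {s : ℕ} (f : Fin s → A) (m : ℕ) : Prop :=
  ∀ l : List (Fin s), l.Nodup → l.length ≤ m →
    RingTheory.Sequence.IsRegular A (l.map f)

/-- `Δ` is (the independence complex of) a matroid on `{1, …, s}`: a nonempty collection of
subsets closed under inclusion and satisfying the augmentation axiom. -/
def IsMatroid {s : ℕ} (Δ : Finset (Fin s) → Prop) : Prop :=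
  Δ ∅ ∧ (∀ F G : Finset (Fin s), Δ F → G ⊆ F → Δ G) ∧
    (∀ F G : Finset (Fin s), Δ F → Δ G → G.card < F.card →
      ∃ j ∈ F, j ∉ G ∧ Δ (insert j G))

/-- `F` is a basis (facet) of the simplicial complex `Δ`: a maximal face. -/
def IsBasisOf {s : ℕ} (Δ : Finset (Fin s) → Prop) (F : Finset (Fin s)) : Prop :=
  Δ F ∧ ∀ G : Finset (Fin s), Δ G → F ⊆ G → G = F

/-- The Stanley–Reisner ideal of `Δ`, generated by the squarefree monomials corresponding
to the non-faces of `Δ`. -/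
def stanleyReisnerIdeal (k : Type) [Field k] {s : ℕ} (Δ : Finset (Fin s) → Prop) :
    Ideal (MvPolynomial (Fin s) k) :=
  Ideal.span
    ((fun F : Finset (Fin s) => ∏ i ∈ F, (X i : MvPolynomial (Fin s) k)) '' {F | ¬ Δ F})

/-- The ideal `I_{W_c}`: the intersection of all ideals `(A_{i_1,j_1}, …, A_{i_c,j_c})`
where `i_1 < ⋯ < i_c` and each generator is chosen from a different group. -/
def multiPartiteIdeal {A : Type*} [CommRing A] {s : ℕ} (c : ℕ) {e : Fin s → ℕ}
    (g : (i : Fin s) → Fin (e i) → A) : Ideal A :=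
  ⨅ T ∈ {T : Finset (Fin s) | T.card = c}, ⨅ j : (i : Fin s) → Fin (e i),
    Ideal.span ((fun i => g i (j i)) '' ↑T)

end

/-- Multiplication by `f i` is injective modulo `(f_j : j ∈ T)` whenever `T ⊆ U` has at most `c`
elements and `i ∈ U \ T`. -/
def RegularOnSubsets {ι A : Type*} [CommRing A] (f : ι → A) (U : Finset ι) (c : ℕ) : Prop :=
  ∀ T ⊆ U, T.card ≤ c → ∀ i ∈ U, i ∉ T →
    ∀ x, f i * x ∈ Ideal.span (f '' (T : Set ι)) → x ∈ Ideal.span (f '' (T : Set ι))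

lemma RegularOnSubsets.mono {ι A : Type*} [CommRing A] {f : ι → A} {U V : Finset ι} {c c' : ℕ}
    (h : RegularOnSubsets f U c) (hV : V ⊆ U) (hc : c' ≤ c) : RegularOnSubsets f V c' :=
  fun T hT hTc i hi => h T (hT.trans hV) (hTc.trans hc) i (hV hi)

lemma span_image_insert {ι A : Type*} [DecidableEq ι] [CommRing A] (f : ι → A) (i : ι)
    (T : Finset ι) :
    Ideal.span (f '' ((insert i T : Finset ι) : Set ι)) =
      Ideal.span {f i} ⊔ Ideal.span (f '' (T : Set ι)) := by
  rw [Finset.coe_insert, Set.image_insert_eq, Ideal.span_insert]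

lemma span_image_quotient {ι A : Type*} [CommRing A] (f : ι → A) (a : A) (T : Set ι) :
    Ideal.span ((fun j => Ideal.Quotient.mk (Ideal.span {a}) (f j)) '' T) =
      (Ideal.span (f '' T)).map (Ideal.Quotient.mk (Ideal.span {a})) := by
  rw [Ideal.map_span, Set.image_image]

lemma mk_mem_span_image_quotient_iff {ι A : Type*} [DecidableEq ι] [CommRing A] (f : ι → A)
    (i : ι) (T : Finset ι) (x : A) :
    Ideal.Quotient.mk (Ideal.span {f i}) x ∈
      Ideal.span ((fun j => Ideal.Quotient.mk (Ideal.span {f i}) (f j)) '' (T : Set ι)) ↔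
      x ∈ Ideal.span (f '' ((insert i T : Finset ι) : Set ι)) := by
  rw [span_image_quotient, Ideal.mem_quotient_iff_mem_sup, span_image_insert, sup_comm]

lemma mk_mem_span_image_pow {ι A : Type*} [DecidableEq ι] [CommRing A] (f : ι → A)
    (i : ι) (T : Finset ι) {w : ℕ} {x : A}
    (hx : x ∈ Ideal.span (f '' ((insert i T : Finset ι) : Set ι)) ^ w) :
    Ideal.Quotient.mk (Ideal.span {f i}) x ∈
      Ideal.span ((fun j => Ideal.Quotient.mk (Ideal.span {f i}) (f j)) '' (T : Set ι)) ^ w := by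
  have h := Ideal.mem_map_of_mem (Ideal.Quotient.mk (Ideal.span {f i})) hx
  rwa [Ideal.map_pow, span_image_insert, Ideal.map_sup, Ideal.map_quotient_self, bot_sup_eq,
    ← span_image_quotient] at h

lemma RegularOnSubsets.quotient {ι A : Type*} [DecidableEq ι] [CommRing A] {f : ι → A}
    {U : Finset ι} {c : ℕ} (h : RegularOnSubsets f U (c + 1)) {i : ι} (hi : i ∈ U) :
    RegularOnSubsets (fun j => Ideal.Quotient.mk (Ideal.span {f i}) (f j)) (U.erase i) c := by
  intro T hT hTc j hj hjT x hx
  obtain ⟨x, rfl⟩ := Ideal.Quotient.mk_surjective x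
  rw [← map_mul, mk_mem_span_image_quotient_iff] at hx
  rw [mk_mem_span_image_quotient_iff]
  refine h _ (Finset.insert_subset hi (hT.trans (U.erase_subset i))) ?_ j
    (Finset.mem_of_mem_erase hj) ?_ x hx
  · exact (Finset.card_insert_le _ _).trans (by lia)
  · simp [hjT, Finset.ne_of_mem_erase hj]

lemma sup_pow_succ_le {A : Type*} [CommRing A] (K L : Ideal A) (w : ℕ) :
    (K ⊔ L) ^ (w + 1) ≤ K * (K ⊔ L) ^ w ⊔ L ^ (w + 1) := by
  induction w with
  | zero => simp
  | succ w ih =>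
    calc (K ⊔ L) ^ (w + 1 + 1) = K * (K ⊔ L) ^ (w + 1) ⊔ L * (K ⊔ L) ^ (w + 1) := by
          rw [pow_succ' _ (w + 1), Ideal.sup_mul]
      _ ≤ K * (K ⊔ L) ^ (w + 1) ⊔ L * (K * (K ⊔ L) ^ w ⊔ L ^ (w + 1)) :=
          sup_le_sup_left (Ideal.mul_mono_right ih) _
      _ ≤ _ := by
          rw [Ideal.mul_sup, ← pow_succ', ← sup_assoc]
          refine sup_le_sup_right (sup_le le_rfl ?_) _
          rw [mul_left_comm, pow_succ']
          exact Ideal.mul_mono_right (Ideal.mul_mono_left le_sup_right)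

lemma mem_sup_pow_succ {A : Type*} [CommRing A] {a x : A} {L : Ideal A} {w : ℕ}
    (hx : x ∈ (Ideal.span {a} ⊔ L) ^ (w + 1)) :
    ∃ u ∈ (Ideal.span {a} ⊔ L) ^ w, x - a * u ∈ L ^ (w + 1) := by
  obtain ⟨y, hy, z, hz, rfl⟩ := Submodule.mem_sup.1 (sup_pow_succ_le _ _ _ hx)
  obtain ⟨u, hu, rfl⟩ := Ideal.mem_span_singleton_mul.1 hy
  exact ⟨u, hu, by simpa using hz⟩

/-- If `a` is injective modulo all powers of `L`, it has order one with respect to `(a) + L`. -/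
lemma mem_sup_pow_of_mul_mem {A : Type*} [CommRing A] {a z : A} {L : Ideal A}
    (ha : ∀ w x, a * x ∈ L ^ w → x ∈ L ^ w) {w : ℕ}
    (hz : a * z ∈ (Ideal.span {a} ⊔ L) ^ (w + 1)) : z ∈ (Ideal.span {a} ⊔ L) ^ w := by
  obtain ⟨u, hu, hv⟩ := mem_sup_pow_succ hz
  rw [← mul_sub] at hv
  have h := Ideal.pow_right_mono (le_sup_right (a := Ideal.span {a})) w
    (Ideal.pow_le_pow_right (Nat.le_succ w) (ha _ _ hv))
  simpa using add_mem h hu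

/-- An element which is a nonzerodivisor modulo an ideal generated by a permutable regular
sequence is a nonzerodivisor modulo all powers of that ideal. -/
lemma mem_pow_of_mul_mem_pow {ι : Type*} [DecidableEq ι] {A : Type*} [CommRing A] (T : Finset ι)
    (f : ι → A) (h : RegularOnSubsets f T T.card) (g : A)
    (hg : ∀ x, g * x ∈ Ideal.span (f '' (T : Set ι)) → x ∈ Ideal.span (f '' (T : Set ι)))
    (w : ℕ) (x : A) (hx : g * x ∈ Ideal.span (f '' (T : Set ι)) ^ w) :
    x ∈ Ideal.span (f '' (T : Set ι)) ^ w := by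
  induction T using Finset.induction_on generalizing A w x with
  | empty =>
    rcases w with _ | w
    · simp
    · simp only [Finset.coe_empty, Set.image_empty, Ideal.span_empty] at hx hg ⊢
      rw [← Ideal.zero_eq_bot, zero_pow w.succ_ne_zero] at hx ⊢
      exact hg x hx
  | insert i T hi ih =>
    rw [Finset.card_insert_of_notMem hi] at h
    have hquot := h.quotient (Finset.mem_insert_self i T)
    rw [Finset.erase_insert hi] at hquot
    have hfi : ∀ w x, f i * x ∈ Ideal.span (f '' (T : Set ι)) ^ w →
        x ∈ Ideal.span (f '' (T : Set ι)) ^ w := fun w x hx =>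
      ih f (h.mono (Finset.subset_insert i T) (Nat.le_succ _)) (f i)
        (h T (Finset.subset_insert i T) (Nat.le_succ _) i (Finset.mem_insert_self i T) hi) w x hx
    induction w generalizing x with
    | zero => simp
    | succ w ihw =>
      have key : Ideal.Quotient.mk (Ideal.span {f i}) x ∈
          Ideal.span ((fun j => Ideal.Quotient.mk (Ideal.span {f i}) (f j)) '' (T : Set ι)) ^
            (w + 1) := by
        have hgbar : ∀ y : A ⧸ Ideal.span {f i}, Ideal.Quotient.mk (Ideal.span {f i}) g * y ∈
            Ideal.span ((fun j => Ideal.Quotient.mk (Ideal.span {f i}) (f j)) '' (T : Set ι)) →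
            y ∈ Ideal.span
              ((fun j => Ideal.Quotient.mk (Ideal.span {f i}) (f j)) '' (T : Set ι)) := by
          intro y hy
          obtain ⟨y, rfl⟩ := Ideal.Quotient.mk_surjective y
          rw [← map_mul, mk_mem_span_image_quotient_iff] at hy
          rw [mk_mem_span_image_quotient_iff]
          exact hg y hy
        have hgx := mk_mem_span_image_pow f i T hx
        rw [map_mul] at hgx
        exact ih (fun j => Ideal.Quotient.mk (Ideal.span {f i}) (f j)) hquot
          (Ideal.Quotient.mk (Ideal.span {f i}) g) hgbar (w + 1)
          (Ideal.Quotient.mk (Ideal.span {f i}) x) hgx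
      rw [span_image_quotient, ← Ideal.map_pow, Ideal.mem_quotient_iff_mem_sup] at key
      obtain ⟨v, hv, y, hy, rfl⟩ := Submodule.mem_sup.1 key
      obtain ⟨z, rfl⟩ := Ideal.mem_span_singleton'.1 hy
      rw [span_image_insert] at hx ihw hg ⊢
      have hv' := Ideal.pow_right_mono (le_sup_right (a := Ideal.span {f i})) (w + 1) hv
      refine add_mem hv' ?_
      have hz : f i * (g * z) ∈
          (Ideal.span {f i} ⊔ Ideal.span (f '' (T : Set ι))) ^ (w + 1) := by
        have := sub_mem hx (Ideal.mul_mem_left _ g hv')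
        convert this using 1
        ring
      rw [mul_comm, pow_succ']
      exact Ideal.mul_mem_mul (Ideal.mem_sup_left (Ideal.mem_span_singleton_self _))
        (ihw z (mem_sup_pow_of_mul_mem hfi hz))

lemma RegularOnSubsets.mem_pow_of_mul_mem_pow_succ {ι : Type*} [DecidableEq ι] {A : Type*}
    [CommRing A] {f : ι → A} {T : Finset ι} {i : ι} (hi : i ∈ T)
    (h : RegularOnSubsets f T (T.card - 1)) {w : ℕ} {z : A}
    (hz : f i * z ∈ Ideal.span (f '' (T : Set ι)) ^ (w + 1)) :
    z ∈ Ideal.span (f '' (T : Set ι)) ^ w := by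
  have hcard := Finset.card_erase_of_mem hi
  rw [← Finset.insert_erase hi, span_image_insert] at hz ⊢
  exact mem_sup_pow_of_mul_mem (mem_pow_of_mul_mem_pow _ f
    (h.mono (T.erase_subset i) hcard.le) _
    (h _ (T.erase_subset i) hcard.le i hi (Finset.notMem_erase i T))) hz

/-- The exponents `a` whose `b`-shifted sums over all `c`-subsets of `U` are at least `m`. -/
def configExponents {ι : Type*} (U : Finset ι) (c m : ℕ) (b : ι → ℕ) : Set (ι → ℕ) :=
  {a | ∀ T ⊆ U, T.card = c → m ≤ ∑ i ∈ T, (a i + b i)}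

/-- The ideal generated by the monomials in the `f i` with exponents in `configExponents`. -/
def configMonomialIdeal {ι A : Type*} [CommRing A] (f : ι → A) (U : Finset ι) (c m : ℕ)
    (b : ι → ℕ) : Ideal A :=
  Ideal.span ((fun a : ι → ℕ => ∏ i ∈ U, f i ^ a i) '' configExponents U c m b)

lemma prod_pow_mem_span_pow {ι A : Type*} [CommRing A] (f : ι → A)
    (T : Finset ι) (a : ι → ℕ) :
    ∏ i ∈ T, f i ^ a i ∈ Ideal.span (f '' (T : Set ι)) ^ ∑ i ∈ T, a i := by
  rw [← Finset.prod_pow_eq_pow_sum]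
  exact Ideal.prod_mem_prod fun i hi =>
    Ideal.pow_mem_pow (Ideal.subset_span (Set.mem_image_of_mem f hi)) _

lemma configMonomialIdeal_le {ι A : Type*} [CommRing A] (f : ι → A)
    {U T : Finset ι} {c m : ℕ} {b : ι → ℕ} (hT : T ⊆ U) (hTc : T.card = c) :
    configMonomialIdeal f U c m b ≤ Ideal.span (f '' (T : Set ι)) ^ (m - ∑ i ∈ T, b i) := by
  rw [configMonomialIdeal, Ideal.span_le]
  rintro _ ⟨a, ha, rfl⟩
  have hm := ha T hT hTc
  rw [Finset.sum_add_distrib] at hm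
  refine Ideal.mem_of_dvd _ (Finset.prod_dvd_prod_of_subset _ _ (fun i => f i ^ a i) hT) ?_
  exact Ideal.pow_le_pow_right (by lia) (prod_pow_mem_span_pow f T a)

/-- The intersection of the powers `(f_i : i ∈ T) ^ (m - b(T))` over the `c`-subsets `T` of `U` is
generated by monomials in the `f i`, if any `c + 1` of the `f i` form a regular sequence. -/
theorem mem_configMonomialIdeal {ι A : Type*} [DecidableEq ι] [CommRing A] (c : ℕ) (f : ι → A)
    (U : Finset ι) (h : RegularOnSubsets f U c) (m : ℕ) (b : ι → ℕ) (x : A)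
    (hx : ∀ T ⊆ U, T.card = c → x ∈ Ideal.span (f '' (T : Set ι)) ^ (m - ∑ i ∈ T, b i)) :
    x ∈ configMonomialIdeal f U c m b := by
  induction c generalizing A U m b x with
  | zero =>
    have h0 := hx ∅ (Finset.empty_subset U) rfl
    rcases m with _ | m
    · exact Ideal.mem_of_dvd _ (one_dvd x)
        (Ideal.subset_span ⟨0, fun _ _ _ => Nat.zero_le _, by simp⟩)
    · rw [Finset.sum_empty, Finset.coe_empty, Set.image_empty, Ideal.span_empty,
        ← Ideal.zero_eq_bot, tsub_zero, zero_pow m.succ_ne_zero] at h0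
      rw [(Submodule.mem_bot A).1 h0]
      exact zero_mem _
  | succ c ih =>
    induction hN : ∑ i ∈ U, (m - b i) using Nat.strong_induction_on generalizing b x with
    | _ N ihN =>
    by_cases hlarge : ∀ i ∈ U, m ≤ b i
    · refine Ideal.mem_of_dvd _ (one_dvd x) (Ideal.subset_span ⟨0, fun T hT hTc => ?_, by simp⟩)
      obtain ⟨j, hj⟩ := Finset.card_pos.1 (c.succ_pos.trans_eq hTc.symm)
      exact (hlarge j (hT hj)).trans
        (by simpa using Finset.single_le_sum (f := b) (fun _ _ => Nat.zero_le _) hj)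
    · push Not at hlarge
      obtain ⟨i₁, hi₁, hlt⟩ := hlarge
      obtain ⟨i, hi, hmin⟩ := U.exists_min_image b ⟨i₁, hi₁⟩
      have him : b i < m := (hmin i₁ hi₁).trans_lt hlt
      have hbar := ih (fun j => Ideal.Quotient.mk (Ideal.span {f i}) (f j)) (U.erase i)
        (h.quotient hi) (m - b i) b (Ideal.Quotient.mk _ x) (fun T hT hTc => by
          have hiT : i ∉ T := fun hiT => Finset.notMem_erase i U (hT hiT)
          have hxT := hx (insert i T) (Finset.insert_subset hi (hT.trans (U.erase_subset i)))
            (by rw [Finset.card_insert_of_notMem hiT, hTc])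
          rw [Finset.sum_insert hiT, ← Nat.sub_sub] at hxT
          exact mk_mem_span_image_pow f i T hxT)
      have hlift : x ∈ configMonomialIdeal f U (c + 1) m b ⊔ Ideal.span {f i} := by
        rw [← Ideal.mem_quotient_iff_mem_sup]
        refine Ideal.span_le.2 ?_ hbar
        rintro _ ⟨a, ha, rfl⟩
        have : Ideal.Quotient.mk (Ideal.span {f i})
            (∏ j ∈ U, f j ^ (Function.update a i 0) j) ∈
            (configMonomialIdeal f U (c + 1) m b).map (Ideal.Quotient.mk (Ideal.span {f i})) := by
          refine Ideal.mem_map_of_mem _ (Ideal.subset_span ⟨_, fun T hT hTc => ?_, rfl⟩)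
          obtain ⟨j, hj, hjmin⟩ : ∃ j ∈ T, T.erase j ⊆ U.erase i := by
            by_cases hiT : i ∈ T
            · exact ⟨i, hiT, Finset.erase_subset_erase i hT⟩
            · obtain ⟨j, hj⟩ := Finset.card_pos.1 (c.succ_pos.trans_eq hTc.symm)
              refine ⟨j, hj, fun l hl => Finset.mem_erase.2 ⟨?_, hT (Finset.mem_of_mem_erase hl)⟩⟩
              rintro rfl
              exact hiT (Finset.mem_of_mem_erase hl)
          have hs := ha (T.erase j) hjmin (by rw [Finset.card_erase_of_mem hj, hTc]; rfl)
          have hle := hmin j (hT hj)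
          rw [← Finset.add_sum_erase _ _ hj]
          have hcongr : ∑ l ∈ T.erase j, (Function.update a i 0 l + b l) =
              ∑ l ∈ T.erase j, (a l + b l) := Finset.sum_congr rfl fun l hl => by
            rw [Function.update_of_ne (Finset.ne_of_mem_erase (hjmin hl))]
          rw [hcongr]
          lia
        have hprod : ∏ j ∈ U, f j ^ (Function.update a i 0) j = ∏ j ∈ U.erase i, f j ^ a j := by
          rw [← Finset.mul_prod_erase _ _ hi, Function.update_self, pow_zero, one_mul]
          exact Finset.prod_congr rfl fun l hl => by
            rw [Function.update_of_ne (Finset.ne_of_mem_erase hl)]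
        rw [hprod, map_prod] at this
        simpa only [map_pow, SetLike.mem_coe] using this
      obtain ⟨y, hy, v, hv, rfl⟩ := Submodule.mem_sup.1 hlift
      obtain ⟨z, rfl⟩ := Ideal.mem_span_singleton.1 hv
      refine add_mem hy ?_
      have hfz : ∀ T ⊆ U, T.card = c + 1 →
          f i * z ∈ Ideal.span (f '' (T : Set ι)) ^ (m - ∑ j ∈ T, b j) := fun T hT hTc => by
        simpa using sub_mem (hx T hT hTc) (configMonomialIdeal_le f hT hTc hy)
      have hz := ihN (∑ j ∈ U, (m - (Function.update b i (b i + 1)) j)) (by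
          rw [← hN]
          refine Finset.sum_lt_sum (fun j _ => ?_) ⟨i, hi, ?_⟩
          · rcases eq_or_ne j i with rfl | hne
            · rw [Function.update_self]; lia
            · rw [Function.update_of_ne hne]
          · rw [Function.update_self]; lia) (Function.update b i (b i + 1)) z (fun T hT hTc => by
          by_cases hiT : i ∈ T
          · have hzT := hfz T hT hTc
            have hsum : ∑ j ∈ T, Function.update b i (b i + 1) j = ∑ j ∈ T, b j + 1 := by
              rw [← Finset.add_sum_erase _ _ hiT, ← Finset.add_sum_erase _ b hiT,
                Function.update_self, Finset.sum_congr rfl fun l hl =>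
                  Function.update_of_ne (Finset.ne_of_mem_erase hl) _ _]
              ring
            rw [hsum, ← Nat.sub_sub]
            rcases hw : m - ∑ j ∈ T, b j with _ | w
            · simp
            · rw [hw] at hzT
              exact (h.mono hT (by lia)).mem_pow_of_mul_mem_pow_succ hiT hzT
          · rw [Finset.sum_congr rfl fun l hl =>
              Function.update_of_ne (ne_of_mem_of_not_mem hl hiT) _ _]
            exact mem_pow_of_mul_mem_pow T f (h.mono hT hTc.le) (f i)
              (h T hT hTc.le i hi hiT) _ _ (hfz T hT hTc)) rfl
      have hmul : Ideal.span {f i} * configMonomialIdeal f U (c + 1) m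
          (Function.update b i (b i + 1)) ≤ configMonomialIdeal f U (c + 1) m b := by
        rw [configMonomialIdeal, Ideal.span_mul_span', Ideal.span_le]
        rintro _ ⟨_, rfl, _, ⟨a, ha, rfl⟩, rfl⟩
        refine Ideal.subset_span ⟨a + Pi.single i 1, fun T hT hTc => ?_, ?_⟩
        · refine (ha T hT hTc).trans_eq (Finset.sum_congr rfl fun j _ => ?_)
          rcases eq_or_ne j i with rfl | hne
          · simp; ring
          · simp [hne]
        · simp only [Pi.add_apply, pow_add, Finset.prod_mul_distrib]
          rw [mul_comm]
          congr 1
          rw [← Finset.mul_prod_erase _ _ hi, Finset.prod_eq_one fun l hl => by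
            rw [Pi.single_eq_of_ne (Finset.ne_of_mem_erase hl), pow_zero]]
          simp
      exact hmul (Ideal.mul_mem_mul (Ideal.mem_span_singleton_self _) hz)

lemma card_mul_le_mul_sum {ι : Type*} [DecidableEq ι] (a : ι → ℕ) (c m : ℕ) (U : Finset ι)
    (hcU : c ≤ U.card) (h : ∀ T ⊆ U, T.card = c → m ≤ ∑ i ∈ T, a i) :
    U.card * m ≤ c * ∑ i ∈ U, a i := by
  induction hq : U.card - c generalizing U with
  | zero =>
    have hU : U.card = c := by lia
    rw [hU]
    exact Nat.mul_le_mul_left c (h U subset_rfl hU)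
  | succ q ih =>
    have hstep : ∀ i ∈ U, (U.card - 1) * m + c * a i ≤ c * ∑ j ∈ U, a j := fun i hi => by
      have hcard := Finset.card_erase_of_mem hi
      have := ih (U.erase i) (by lia) (fun T hT => h T (hT.trans (U.erase_subset i))) (by lia)
      rw [hcard] at this
      rw [← Finset.add_sum_erase U a hi, mul_add]
      lia
    have hsum := Finset.sum_le_sum hstep
    rw [Finset.sum_add_distrib, Finset.sum_const, Finset.sum_const, ← Finset.mul_sum,
      smul_eq_mul, smul_eq_mul] at hsum
    obtain ⟨p, hp⟩ : ∃ p, U.card = p + 1 := ⟨U.card - 1, by lia⟩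
    have hppos : 0 < p ∨ c = 0 := by lia
    rw [hp] at hsum ⊢
    rcases hppos with hppos | rfl
    · refine Nat.le_of_mul_le_mul_left ?_ hppos
      simp only [Nat.add_sub_cancel] at hsum
      nlinarith
    · have hm := h ∅ (Finset.empty_subset U) rfl
      simp only [Finset.sum_empty, nonpos_iff_eq_zero] at hm
      simp [hm]

lemma mul_le_sum_min {ι : Type*} [DecidableEq ι] (a : ι → ℕ) (U : Finset ι) {c m r : ℕ}
    (hc : 1 ≤ c) (hcU : c ≤ U.card) (h : ∀ T ⊆ U, T.card = c → m ≤ ∑ i ∈ T, a i)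
    (hmr : r * (c * (U.card - c + 1)) ≤ m * U.card) :
    r * (U.card - c + 1) ≤ ∑ i ∈ U, min (a i) r := by
  set V := U.filter fun i => a i < r with hV
  have hVU : V ⊆ U := Finset.filter_subset _ _
  have hsplit : ∑ i ∈ U, min (a i) r = ∑ i ∈ V, a i + (U.card - V.card) * r := by
    rw [← Finset.sum_filter_add_sum_filter_not U fun i => a i < r]
    congr 1
    · exact Finset.sum_congr rfl fun i hi => min_eq_left (Finset.mem_filter.1 hi).2.le
    · rw [Finset.sum_congr rfl fun i hi => min_eq_right (not_lt.1 (Finset.mem_filter.1 hi).2),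
        Finset.sum_const, smul_eq_mul]
      have := Finset.card_filter_add_card_filter_not (s := U) (fun i => a i < r)
      rw [← hV] at this
      congr 1
      lia
  have hVc := Finset.card_le_card hVU
  obtain ⟨p, hp⟩ := Nat.exists_eq_add_of_le hVc
  rw [hsplit, hp, Nat.add_sub_cancel_left]
  rcases lt_or_ge V.card c with hlt | hge
  · have : V.card + p - c + 1 ≤ p := by lia
    exact (Nat.mul_le_mul_left r this).trans (by rw [mul_comm]; exact Nat.le_add_left _ _)
  · have hA := card_mul_le_mul_sum a c m V hge fun T hT => h T (hT.trans hVU)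
    obtain ⟨q, hq⟩ := Nat.exists_eq_add_of_le hge
    obtain ⟨e, rfl⟩ := Nat.exists_eq_add_of_le hc
    set S := ∑ i ∈ V, a i
    have h1 : V.card + p - (1 + e) + 1 = q + p + 1 := by lia
    rw [hp, h1] at hmr
    rw [h1]
    have hq' : V.card = 1 + e + q := hq
    rw [hq'] at hmr hA
    suffices (1 + e) * (1 + e + q + p) * (r * (q + 1)) ≤ (1 + e) * (1 + e + q + p) * S by
      have := Nat.le_of_mul_le_mul_left this (by positivity)
      nlinarith
    calc (1 + e) * (1 + e + q + p) * (r * (q + 1))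
        ≤ (1 + e + q) * (r * ((1 + e) * (q + p + 1))) := by
          have : 0 ≤ (1 + e) * r * (p * e) := Nat.zero_le _
          nlinarith
      _ ≤ (1 + e + q) * (m * (1 + e + q + p)) := Nat.mul_le_mul_left _ hmr
      _ = (1 + e + q + p) * ((1 + e + q) * m) := by ring
      _ ≤ (1 + e + q + p) * ((1 + e) * S) := Nat.mul_le_mul_left _ hA
      _ = _ := by ring

lemma exists_le_sum_eq {ι : Type*} [DecidableEq ι] (U : Finset ι) (a : ι → ℕ) {N : ℕ}
    (hN : N ≤ ∑ i ∈ U, a i) : ∃ b : ι → ℕ, b ≤ a ∧ ∑ i ∈ U, b i = N := by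
  induction hd : ∑ i ∈ U, a i - N generalizing a with
  | zero => exact ⟨a, le_rfl, by lia⟩
  | succ n ih =>
    obtain ⟨i, hi, hpos⟩ : ∃ i ∈ U, 0 < a i := by
      by_contra! hcon
      have : ∑ i ∈ U, a i = 0 := Finset.sum_eq_zero fun i hi => Nat.le_zero.1 (hcon i hi)
      lia
    have hsum : ∑ j ∈ U, Function.update a i (a i - 1) j + 1 = ∑ j ∈ U, a j := by
      rw [← Finset.add_sum_erase _ _ hi, ← Finset.add_sum_erase _ a hi, Function.update_self,
        Finset.sum_congr rfl fun l hl => Function.update_of_ne (Finset.ne_of_mem_erase hl) _ _]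
      lia
    obtain ⟨b, hb, hbN⟩ := ih (Function.update a i (a i - 1)) (by lia) (by lia)
    refine ⟨b, hb.trans fun j => ?_, hbN⟩
    rcases eq_or_ne j i with rfl | hne
    · simp
    · simp [hne]

lemma prod_pow_mem_pow_of_sum_eq {ι A : Type*} [DecidableEq ι] [CommRing A] (f : ι → A)
    (U : Finset ι) {e : ℕ} {E : Ideal A} (hE : ∀ V ⊆ U, V.card = e → ∏ i ∈ V, f i ∈ E)
    (r : ℕ) (a : ι → ℕ) (har : ∀ i ∈ U, a i ≤ r) (hsum : ∑ i ∈ U, a i = r * e) :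
    ∏ i ∈ U, f i ^ a i ∈ E ^ r := by
  induction r generalizing a with
  | zero => simp
  | succ r ih =>
    have hH : (U.filter fun i => a i = r + 1).card ≤ e := by
      have : ∑ i ∈ U.filter (fun i => a i = r + 1), a i ≤ ∑ i ∈ U, a i :=
        Finset.sum_le_sum_of_subset (Finset.filter_subset _ _)
      rw [Finset.sum_congr rfl fun i hi => (Finset.mem_filter.1 hi).2, Finset.sum_const, hsum,
        smul_eq_mul, mul_comm] at this
      exact Nat.le_of_mul_le_mul_left this r.succ_pos
    have hP : e ≤ (U.filter fun i => 0 < a i).card := by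
      have h1 : ∑ i ∈ U, a i = ∑ i ∈ U.filter (fun i => 0 < a i), a i := by
        symm
        refine Finset.sum_subset (Finset.filter_subset _ _) fun i hi hni => ?_
        by_contra hne
        exact hni (Finset.mem_filter.2 ⟨hi, Nat.pos_of_ne_zero hne⟩)
      have h2 := Finset.sum_le_card_nsmul (U.filter fun i => 0 < a i) a (r + 1)
        fun i hi => har i (Finset.mem_filter.1 hi).1
      rw [← h1, hsum, smul_eq_mul, mul_comm _ (r + 1)] at h2
      exact Nat.le_of_mul_le_mul_left h2 r.succ_pos
    obtain ⟨V, hHV, hVP, hVe⟩ := Finset.exists_subsuperset_card_eq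
      (fun i hi => by
        obtain ⟨hiU, hir⟩ := Finset.mem_filter.1 hi
        exact Finset.mem_filter.2 ⟨hiU, by lia⟩) hH hP
    have hVU : V ⊆ U := hVP.trans (Finset.filter_subset _ _)
    have hdecomp : ∀ i ∈ U, a i = (a i - if i ∈ V then 1 else 0) + if i ∈ V then 1 else 0 := by
      intro i _
      split_ifs with hi
      · have := (Finset.mem_filter.1 (hVP hi)).2
        lia
      · simp
    have hone : ∑ i ∈ U, (if i ∈ V then 1 else 0) = e := by
      rw [Finset.sum_ite_mem, Finset.inter_eq_right.2 hVU, Finset.sum_const, smul_eq_mul, mul_one,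
        hVe]
    have hrest := ih (fun i => a i - if i ∈ V then 1 else 0) (fun i hi => by
      have := har i hi
      by_cases hiV : i ∈ V
      · simp only [hiV, if_true]; lia
      · have : a i ≠ r + 1 := fun h => hiV (hHV (Finset.mem_filter.2 ⟨hi, h⟩))
        simp only [hiV, if_false]; lia) (by
      rw [Finset.sum_congr rfl hdecomp, Finset.sum_add_distrib, hone, Nat.succ_mul] at hsum
      exact Nat.add_right_cancel hsum)
    rw [Finset.prod_congr rfl fun i hi => by rw [hdecomp i hi, pow_add], Finset.prod_mul_distrib,
      pow_succ]
    refine Ideal.mul_mem_mul hrest ?_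
    have : ∏ i ∈ U, f i ^ (if i ∈ V then 1 else 0) = ∏ i ∈ V, f i := by
      simp only [pow_ite, pow_one, pow_zero]
      rw [Finset.prod_ite_mem, Finset.inter_eq_right.2 hVU]
    rw [this]
    exact hE V hVU hVe

lemma configMonomialIdeal_le_pow {ι A : Type*} [DecidableEq ι] [CommRing A] (f : ι → A)
    (U : Finset ι) {c m r : ℕ} (hc : 1 ≤ c) (hcU : c ≤ U.card) {E : Ideal A}
    (hE : ∀ V ⊆ U, V.card = U.card - c + 1 → ∏ i ∈ V, f i ∈ E)
    (hmr : r * (c * (U.card - c + 1)) ≤ m * U.card) :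
    configMonomialIdeal f U c m 0 ≤ E ^ r := by
  rw [configMonomialIdeal, Ideal.span_le]
  rintro _ ⟨a, ha, rfl⟩
  obtain ⟨b, hb, hsum⟩ := exists_le_sum_eq U (fun i => min (a i) r)
    (mul_le_sum_min a U hc hcU (by simpa [configExponents] using ha) hmr)
  exact Ideal.mem_of_dvd _
    (Finset.prod_dvd_prod_of_dvd _ _ fun i _ => pow_dvd_pow _ ((hb i).trans (min_le_left _ _)))
    (prod_pow_mem_pow_of_sum_eq f U hE r b (fun i _ => (hb i).trans (min_le_right _ _)) hsum)

lemma mem_configIdeal {A : Type*} [CommRing A] {s c : ℕ} {f : Fin s → A} {x : A} :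
    x ∈ configIdeal c f ↔
      ∀ T : Finset (Fin s), T.card = c → x ∈ Ideal.span (f '' (T : Set (Fin s))) := by
  simp [configIdeal, Submodule.mem_iInf]

lemma prod_mem_configIdeal {A : Type*} [CommRing A] {s c : ℕ} (f : Fin s → A)
    {V : Finset (Fin s)} (hV : s < V.card + c) : ∏ i ∈ V, f i ∈ configIdeal c f := by
  refine mem_configIdeal.2 fun T hT => ?_
  obtain ⟨i, hi⟩ : (V ∩ T).Nonempty :=
    Finset.inter_nonempty_of_card_lt_card_add_card V.subset_univ T.subset_univ (by simpa [hT])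
  rw [Finset.mem_inter] at hi
  exact Ideal.mem_of_dvd _ (Finset.dvd_prod_of_mem f hi.1)
    (Ideal.subset_span (Set.mem_image_of_mem f hi.2))

lemma mem_symbolicPower {A : Type*} [CommRing A] {J : Ideal A} {m : ℕ} {x : A} :
    x ∈ symbolicPower J m ↔
      ∀ P : Ideal A, IsAssociatedPrime P (A ⧸ J) → ∃ u ∉ P, u * x ∈ J ^ m := by
  have key : ∀ (P : Ideal A) (hP : IsAssociatedPrime P (A ⧸ J)),
      x ∈ Ideal.comap (algebraMap A (Localization (@Ideal.primeCompl A _ P hP.1)))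
          (Ideal.map (algebraMap A (Localization (@Ideal.primeCompl A _ P hP.1))) (J ^ m)) ↔
        ∃ u ∉ P, u * x ∈ J ^ m := by
    intro P hP
    rw [Ideal.mem_comap, IsLocalization.algebraMap_mem_map_algebraMap_iff
      (@Ideal.primeCompl A _ P hP.1)]
    rfl
  rw [symbolicPower, Submodule.mem_sInf]
  constructor
  · intro h P hP
    exact (key P hP).1 (h _ ⟨P, hP, rfl⟩)
  · rintro h _ ⟨P, hP, rfl⟩
    exact (key P hP).2 (h P hP)

lemma isAssociatedPrime_quotient_iff {A : Type*} [CommRing A] [IsNoetherianRing A]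
    {P J : Ideal A} :
    IsAssociatedPrime P (A ⧸ J) ↔ P.IsPrime ∧ ∃ y : A, ∀ z, z ∈ P ↔ z * y ∈ J := by
  have key : ∀ y z : A, z ∈ (⊥ : Submodule A (A ⧸ J)).colon {Ideal.Quotient.mk J y} ↔
      z * y ∈ J := by
    intro y z
    rw [Submodule.mem_colon_singleton, Submodule.mem_bot, Algebra.smul_def,
      Ideal.Quotient.algebraMap_eq, ← map_mul, Ideal.Quotient.eq_zero_iff_mem]
  rw [isAssociatedPrime_iff, Ideal.Quotient.mk_surjective.exists]
  simp only [SetLike.ext_iff, key]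

/-- An ideal contained in no associated prime of `A ⧸ J` contains a nonzerodivisor on `A ⧸ J`. -/
lemma exists_mem_nonzerodivisor_mod {A : Type*} [CommRing A] [IsNoetherianRing A] {J K : Ideal A}
    (h : ∀ P : Ideal A, IsAssociatedPrime P (A ⧸ J) → ¬ K ≤ P) :
    ∃ u ∈ K, ∀ x, u * x ∈ J → x ∈ J := by
  by_contra! hcon
  obtain ⟨P, hP, hKP⟩ := (K.subset_union_prime_finite
    (associatedPrimes.finite A (A ⧸ J)) (f := id) 0 0 fun _ hP _ _ => hP.1).1 (by
      simp_rw [id, biUnion_associatedPrimes_eq_zero_divisors]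
      intro u hu
      obtain ⟨x, hux, hx⟩ := hcon u hu
      refine ⟨Ideal.Quotient.mk J x, by rwa [Ne, Ideal.Quotient.eq_zero_iff_mem], ?_⟩
      rwa [Algebra.smul_def, Ideal.Quotient.algebraMap_eq, ← map_mul,
        Ideal.Quotient.eq_zero_iff_mem])
  exact h P hP hKP

lemma prod_compl_mul_mem_span_iff {A : Type*} [CommRing A] {s c : ℕ} {f : Fin s → A}
    (h : RegularOnSubsets f Finset.univ c) {T : Finset (Fin s)} (hT : T.card = c) (x : A) :
    (∏ j ∈ Tᶜ, f j) * x ∈ Ideal.span (f '' (T : Set (Fin s))) ↔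
      x ∈ Ideal.span (f '' (T : Set (Fin s))) := by
  refine ⟨fun hx => ?_, fun hx => Ideal.mul_mem_left _ _ hx⟩
  have aux : ∀ V : Finset (Fin s), Disjoint V T → ∀ x,
      (∏ j ∈ V, f j) * x ∈ Ideal.span (f '' (T : Set (Fin s))) →
        x ∈ Ideal.span (f '' (T : Set (Fin s))) := by
    intro V
    induction V using Finset.induction_on with
    | empty => simp
    | insert i V hi ih =>
      intro hdisj x hx
      rw [Finset.disjoint_insert_left] at hdisj
      rw [Finset.prod_insert hi, mul_assoc] at hx
      exact ih hdisj.2 x (h T T.subset_univ hT.le i (Finset.mem_univ i) hdisj.1 _ hx)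
  exact aux _ disjoint_compl_left x hx

lemma symbolicPower_configIdeal_le {A : Type*} [CommRing A] [IsNoetherianRing A] {s c : ℕ}
    {f : Fin s → A} (h : RegularOnSubsets f Finset.univ c) (m : ℕ) {T : Finset (Fin s)}
    (hT : T.card = c) :
    symbolicPower (configIdeal c f) m ≤ Ideal.span (f '' (T : Set (Fin s))) ^ m := by
  intro x hx
  rw [mem_symbolicPower] at hx
  have hIT : configIdeal c f ≤ Ideal.span (f '' (T : Set (Fin s))) :=
    fun y hy => mem_configIdeal.1 hy T hT
  have hFmem : ∀ y ∈ Ideal.span (f '' (T : Set (Fin s))),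
      (∏ j ∈ Tᶜ, f j) * y ∈ configIdeal c f := by
    refine fun y hy => mem_configIdeal.2 fun T' hT' => ?_
    rcases eq_or_ne T' T with rfl | hne
    · exact Ideal.mul_mem_left _ _ hy
    · obtain ⟨j, hj, hjT⟩ : ∃ j ∈ T', j ∉ T := by
        by_contra! hsub
        exact hne (Finset.eq_of_subset_of_card_le hsub (by rw [hT, hT']))
      exact Ideal.mul_mem_right _ _ (Ideal.mem_of_dvd _
        (Finset.dvd_prod_of_mem f (Finset.mem_compl.2 hjT))
        (Ideal.subset_span (Set.mem_image_of_mem f hj)))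
  obtain ⟨u, hu, hureg⟩ := exists_mem_nonzerodivisor_mod
    (J := Ideal.span (f '' (T : Set (Fin s))))
    (K := (Ideal.span (f '' (T : Set (Fin s))) ^ m).colon {x}) (by
      intro P hP hle
      obtain ⟨hprime, y, hy⟩ := isAssociatedPrime_quotient_iff.1 hP
      have hPI : IsAssociatedPrime P (A ⧸ configIdeal c f) := by
        refine isAssociatedPrime_quotient_iff.2 ⟨hprime, (∏ j ∈ Tᶜ, f j) * y, fun z => ?_⟩
        rw [hy z, mul_left_comm]
        exact ⟨hFmem _, fun hz => (prod_compl_mul_mem_span_iff h hT _).1 (hIT hz)⟩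
      obtain ⟨u, huP, hux⟩ := hx P hPI
      refine huP (hle ?_)
      rw [Submodule.mem_colon_singleton]
      exact Ideal.pow_right_mono hIT m hux)
  rw [Submodule.mem_colon_singleton] at hu
  exact mem_pow_of_mul_mem_pow T f (h.mono T.subset_univ hT.le) u hureg m x hu

lemma prod_pow_mem_symbolicPower {A : Type*} [CommRing A] [IsNoetherianRing A] {s c : ℕ}
    {f : Fin s → A} (h : RegularOnSubsets f Finset.univ c) (t : ℕ) :
    (∏ i, f i) ^ t ∈ symbolicPower (configIdeal c f) (c * t) := by
  refine mem_symbolicPower.2 fun P hP => ?_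
  obtain ⟨hprime, y, hy⟩ := isAssociatedPrime_quotient_iff.1 hP
  obtain ⟨T, hT, hyT⟩ : ∃ T : Finset (Fin s), T.card = c ∧
      y ∉ Ideal.span (f '' (T : Set (Fin s))) := by
    by_contra! hcon
    exact hprime.one_notMem ((hy 1).2 (by rw [one_mul]; exact mem_configIdeal.2 hcon))
  have hfP : ∀ j ∉ T, f j ∉ P := fun j hj hjP =>
    hyT (h T T.subset_univ hT.le j (Finset.mem_univ j) hj y
      (mem_configIdeal.1 ((hy _).1 hjP) T hT))
  set F := ∏ j ∈ Tᶜ, f j with hF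
  have hFP : F ∉ P := by
    rw [hF, Ideal.IsPrime.prod_mem_iff]
    rintro ⟨j, hj, hjP⟩
    exact hfP j (Finset.mem_compl.1 hj) hjP
  have hmem : ∀ i ∈ T, f i * F ∈ configIdeal c f := fun i hi => by
    have hiT : i ∉ Tᶜ := by simpa using hi
    rw [hF, ← Finset.prod_insert hiT]
    refine prod_mem_configIdeal f ?_
    have := Finset.card_compl_add_card T
    rw [Fintype.card_fin] at this
    rw [Finset.card_insert_of_notMem hiT]
    lia
  have hprod : (∏ i ∈ T, f i * F) ^ t ∈ configIdeal c f ^ (c * t) := by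
    have := Ideal.pow_mem_pow (Ideal.prod_mem_prod hmem) t
    rwa [Finset.prod_const, hT, ← pow_mul] at this
  refine ⟨F ^ (c * t), fun hmemP => hFP (hprime.mem_of_pow_mem _ hmemP), ?_⟩
  rw [Finset.prod_mul_distrib, Finset.prod_const, hT] at hprod
  rw [← Finset.prod_mul_prod_compl T f, ← hF]
  convert Ideal.mul_mem_left _ (F ^ t) hprod using 1
  ring

lemma symbolicPower_configIdeal_le_pow {A : Type*} [CommRing A] [IsNoetherianRing A] {s c : ℕ}
    {f : Fin s → A} (h : RegularOnSubsets f Finset.univ c) (hc : 1 ≤ c) (hcs : c ≤ s) {m r : ℕ}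
    (hmr : r * (c * (s - c + 1)) ≤ m * s) :
    symbolicPower (configIdeal c f) m ≤ configIdeal c f ^ r := by
  intro x hx
  refine configMonomialIdeal_le_pow f Finset.univ (c := c) (m := m) hc (by simpa) ?_ (by simpa) ?_
  · intro V _ hV
    rw [Finset.card_univ, Fintype.card_fin] at hV
    exact prod_mem_configIdeal f (by lia)
  · refine mem_configMonomialIdeal c f Finset.univ h m 0 x fun T _ hT => ?_
    simpa using symbolicPower_configIdeal_le h m hT hx

lemma configIdeal_le_span_pow {A : Type*} [CommRing A] {s c : ℕ} {f : Fin s → A}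
    (h : RegularOnSubsets f Finset.univ c) (hcs : c ≤ s) :
    configIdeal c f ≤ Ideal.span (Set.range f) ^ (s - c + 1) := by
  intro x hx
  have hmem : x ∈ configMonomialIdeal f Finset.univ c 1 0 :=
    mem_configMonomialIdeal c f Finset.univ h 1 0 x fun T _ hT => by
      simpa using mem_configIdeal.1 hx T hT
  refine Ideal.span_le.2 ?_ hmem
  rintro _ ⟨a, ha, rfl⟩
  have hprod := prod_pow_mem_span_pow f Finset.univ a
  rw [Finset.coe_univ, Set.image_univ] at hprod
  refine Ideal.pow_le_pow_right ?_ hprod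
  have hzero : (Finset.univ.filter fun i => a i = 0).card < c := by
    by_contra! hge
    obtain ⟨T, hT, hTc⟩ := Finset.exists_subset_card_eq hge
    have := ha T T.subset_univ hTc
    rw [Finset.sum_eq_zero fun i hi => by simpa using (Finset.mem_filter.1 (hT hi)).2] at this
    lia
  have hsplit := Finset.card_filter_add_card_filter_not (s := Finset.univ) (fun i => a i = 0)
  rw [Finset.card_univ, Fintype.card_fin] at hsplit
  have hle : (Finset.univ.filter fun i => ¬ a i = 0).card ≤ ∑ i, a i := by
    rw [Finset.card_filter]
    exact Finset.sum_le_sum fun i _ => by split_ifs <;> lia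
  lia

lemma mem_span_of_isWeaklyRegular {ι A : Type*} [CommRing A] {f : ι → A} {T : Finset ι} {i : ι}
    {l : List ι} (h : RingTheory.Sequence.IsWeaklyRegular A ((T.toList ++ i :: l).map f)) {x : A}
    (hx : f i * x ∈ Ideal.span (f '' (T : Set ι))) : x ∈ Ideal.span (f '' (T : Set ι)) := by
  rw [List.map_append, List.map_cons, RingTheory.Sequence.isWeaklyRegular_append_iff,
    RingTheory.Sequence.isWeaklyRegular_cons_iff] at h
  have hspan : (Ideal.ofList (T.toList.map f) • ⊤ : Submodule A A) =
      Ideal.span (f '' (T : Set ι)) := by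
    rw [smul_eq_mul, Ideal.mul_top, Ideal.ofList]
    congr 1
    ext y
    simp
  rw [← hspan] at hx ⊢
  rw [← Submodule.Quotient.mk_eq_zero] at hx ⊢
  refine h.2.1 ?_
  simp only [smul_zero]
  rw [← Submodule.Quotient.mk_smul]
  exact hx

lemma SubsetsRegular.regularOnSubsets {A : Type*} [CommRing A] {s c : ℕ} {f : Fin s → A}
    (h : SubsetsRegular f (c + 1)) : RegularOnSubsets f Finset.univ c := by
  intro T _ hT i _ hi x hx
  refine mem_span_of_isWeaklyRegular (l := []) (h _ ?_ ?_).toIsWeaklyRegular hx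
  · rw [List.nodup_append]
    refine ⟨T.nodup_toList, List.nodup_singleton i, fun a ha b hb hab => hi ?_⟩
    rwa [← List.mem_singleton.1 hb, ← hab, ← Finset.mem_toList]
  · simpa using hT

section Graded

variable {σ k : Type*} [Field k]

attribute [local instance] MvPolynomial.gradedAlgebra

lemma isHomogeneous_mem_pow_idealOfVars {p : MvPolynomial σ k} {e : ℕ} (hp : p.IsHomogeneous e) :
    p ∈ idealOfVars σ k ^ e := by
  rw [mem_pow_idealOfVars_iff]
  intro x hx
  rw [Finsupp.degree_eq_weight_one]
  exact (hp (mem_support_iff.1 hx)).ge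

/-- A homogeneous ideal is closed in the adic topology of the irrelevant ideal. -/
lemma mem_of_forall_mem_sup_pow_idealOfVars {J : Ideal (MvPolynomial σ k)}
    (hJ : J.IsHomogeneous (homogeneousSubmodule σ k)) {x : MvPolynomial σ k}
    (hx : ∀ N, x ∈ J ⊔ idealOfVars σ k ^ N) : x ∈ J := by
  rw [mem_iff_homogeneousComponent_mem hJ]
  intro e
  obtain ⟨y, hy, z, hz, rfl⟩ := Submodule.mem_sup.1 (hx (e + 1))
  have hz0 : homogeneousComponent e z = 0 := by
    ext v
    rw [coeff_homogeneousComponent, coeff_zero]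
    split_ifs with hv
    · exact (mem_pow_idealOfVars_iff' _ _).1 hz v (by lia)
    · rfl
  rw [map_add, hz0, add_zero]
  exact homogeneousComponent_mem_of_mem hJ hy e

lemma torsionBy_eq_bot_of_eq_smul {J : Ideal (MvPolynomial σ k)}
    (hJ : J.IsHomogeneous (homogeneousSubmodule σ k)) {a : MvPolynomial σ k}
    (ha : a ∈ idealOfVars σ k)
    {K : Submodule (MvPolynomial σ k)
      (MvPolynomial σ k ⧸ (J • ⊤ : Submodule (MvPolynomial σ k) (MvPolynomial σ k)))}
    (hK : ∀ y ∈ K, ∃ z ∈ K, a • z = y) : K = ⊥ := by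
  have hpow : ∀ N, ∀ y ∈ K, ∃ z ∈ K, a ^ N • z = y := by
    intro N
    induction N with
    | zero => exact fun y hy => ⟨y, hy, by simp⟩
    | succ N ih =>
      intro y hy
      obtain ⟨z, hz, rfl⟩ := ih y hy
      obtain ⟨w, hw, rfl⟩ := hK z hz
      exact ⟨w, hw, by rw [pow_succ, mul_smul]⟩
  rw [eq_bot_iff]
  intro y hy
  obtain ⟨x, rfl⟩ := Submodule.Quotient.mk_surjective _ y
  rw [Submodule.mem_bot, Submodule.Quotient.mk_eq_zero, smul_eq_mul, Ideal.mul_top]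
  refine mem_of_forall_mem_sup_pow_idealOfVars hJ fun N => ?_
  obtain ⟨z, -, hz⟩ := hpow N _ hy
  obtain ⟨w, rfl⟩ := Submodule.Quotient.mk_surjective _ z
  rw [← Submodule.Quotient.mk_smul, eq_comm, Submodule.Quotient.eq, smul_eq_mul, smul_eq_mul,
    Ideal.mul_top] at hz
  rw [← sub_add_cancel x (a ^ N * w)]
  exact Submodule.add_mem_sup hz (Ideal.mul_mem_right _ _ (Ideal.pow_mem_pow ha N))

/-- A homogeneous polynomial that is not a unit lies in the irrelevant ideal. -/
lemma mem_idealOfVars_of_isHomogeneous {p : MvPolynomial σ k} {e : ℕ} (hp : p.IsHomogeneous e)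
    (hu : ¬ IsUnit p) : p ∈ idealOfVars σ k := by
  rcases Nat.eq_zero_or_pos e with rfl | he
  · rw [← totalDegree_zero_iff_isHomogeneous] at hp
    rw [totalDegree_eq_zero_iff_eq_C] at hp
    by_cases h0 : coeff 0 p = 0
    · rw [hp, h0, C_0]
      exact zero_mem _
    · exact absurd (hp ▸ (isUnit_iff_ne_zero.2 h0).map C) hu
  · exact Ideal.pow_le_self he.ne' (isHomogeneous_mem_pow_idealOfVars hp)

lemma ofList_ofFn {A : Type*} [CommRing A] {s : ℕ} (f : Fin s → A) :
    Ideal.ofList (List.ofFn f) = Ideal.span (Set.range f) := by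
  rw [Ideal.ofList]
  congr 1
  ext y
  simp

lemma span_range_ne_top_of_isRegular {A : Type*} [CommRing A] {s : ℕ} {f : Fin s → A}
    (h : RingTheory.Sequence.IsRegular A (List.ofFn f)) : Ideal.span (Set.range f) ≠ ⊤ := by
  have := h.top_ne_smul
  rw [smul_eq_mul, Ideal.mul_top, ofList_ofFn] at this
  exact this.symm

lemma regularOnSubsets_of_isRegular {s : ℕ} {f : Fin s → MvPolynomial σ k} {d : Fin s → ℕ}
    (hdeg : ∀ i, (f i).IsHomogeneous (d i))
    (h : RingTheory.Sequence.IsRegular (MvPolynomial σ k) (List.ofFn f)) (c : ℕ) :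
    RegularOnSubsets f Finset.univ c := by
  intro T _ hT i _ hi x hx
  have hperm : (List.ofFn f).Perm ((T.toList ++ i :: (insert i T)ᶜ.toList).map f) := by
    rw [List.ofFn_eq_map]
    refine List.Perm.map f ((List.perm_ext_iff_of_nodup (List.nodup_finRange s) ?_).2 ?_)
    · rw [List.nodup_append]
      refine ⟨T.nodup_toList, ?_, ?_⟩
      · simp [Finset.nodup_toList]
      · intro a ha b hb hab
        subst hab
        rw [Finset.mem_toList] at ha
        rw [List.mem_cons, Finset.mem_toList] at hb
        rcases hb with rfl | hb
        · exact hi ha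
        · simp [ha] at hb
    · intro j
      simp only [List.mem_finRange, List.mem_append, Finset.mem_toList, List.mem_cons,
        Finset.mem_compl, Finset.mem_insert]
      tauto
  refine mem_span_of_isWeaklyRegular (h.toIsWeaklyRegular.prototype_perm hperm ?_) hx
  intro a b l hl K hK
  have hmem : ∀ p ∈ a :: b :: l, ∃ j, f j = p := fun p hp => by
    simpa using hl.subset hp
  refine torsionBy_eq_bot_of_eq_smul (a := a) ?_ ?_ ?_
  · refine Ideal.homogeneous_span _ _ fun p hp => ?_
    obtain ⟨j, rfl⟩ := hmem p (by simp_all)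
    exact ⟨d j, hdeg j⟩
  · obtain ⟨j, rfl⟩ := hmem a (by simp)
    refine mem_idealOfVars_of_isHomogeneous (hdeg j) fun hu => ?_
    exact span_range_ne_top_of_isRegular h
      (Ideal.eq_top_of_isUnit_mem _ (Ideal.subset_span ⟨j, rfl⟩) hu)
  · intro y hy
    rw [hK] at hy
    exact (Submodule.mem_smul_pointwise_iff_exists _ _ _).1 hy

lemma RegularOnSubsets.prod_pow_notMem {A : Type*} [CommRing A] {s : ℕ} {f : Fin s → A}
    (h : RegularOnSubsets f Finset.univ s) (htop : Ideal.span (Set.range f) ≠ ⊤) (a : Fin s → ℕ) :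
    ∏ i, f i ^ a i ∉ Ideal.span (Set.range f) ^ (∑ i, a i + 1) := by
  induction hN : ∑ i, a i generalizing a with
  | zero =>
    have ha : ∀ i, a i = 0 := by simpa using hN
    simpa [ha, ← Ideal.eq_top_iff_one] using htop
  | succ N ih =>
    intro hmem
    obtain ⟨i, -, hi⟩ := Finset.exists_ne_zero_of_sum_ne_zero (hN.trans_ne N.succ_ne_zero)
    have hsum : a = Function.update a i (a i - 1) + Pi.single i 1 := by
      ext j
      by_cases hj : j = i
      · subst hj
        simp only [Pi.add_apply, Function.update_self, Pi.single_eq_same]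
        lia
      · simp [hj]
    refine ih (Function.update a i (a i - 1)) ?_ ?_
    · have : ∑ j, a j = ∑ j, Function.update a i (a i - 1) j + 1 := by
        conv_lhs => rw [hsum]
        simp [Finset.sum_add_distrib]
      lia
    · have hrange : Ideal.span (Set.range f) =
          Ideal.span (f '' ((Finset.univ : Finset (Fin s)) : Set (Fin s))) := by simp
      rw [hrange] at hmem ⊢
      refine RegularOnSubsets.mem_pow_of_mul_mem_pow_succ (i := i) (Finset.mem_univ i)
        (h.mono (Finset.Subset.refl _) (by simp)) ?_
      convert hmem using 1
      conv_rhs => rw [hsum]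
      simp only [Pi.add_apply, pow_add, Finset.prod_mul_distrib]
      rw [mul_comm]
      congr 1
      rw [Finset.prod_eq_single i (fun j _ hj => by simp [hj]) (by simp)]
      simp

lemma prod_pow_notMem_of_isHomogeneous {s : ℕ} {f : Fin s → MvPolynomial σ k} {e : ℕ}
    (he : 1 ≤ e) (hdeg : ∀ i, (f i).IsHomogeneous e) (hf : ∀ i, f i ≠ 0) (t : ℕ) :
    (∏ i, f i) ^ t ∉ Ideal.span (Set.range f) ^ (s * t + 1) := by
  intro hmem
  have hle : Ideal.span (Set.range f) ^ (s * t + 1) ≤ idealOfVars σ k ^ (e * (s * t + 1)) := by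
    rw [pow_mul]
    refine Ideal.pow_right_mono (Ideal.span_le.2 ?_) _
    rintro _ ⟨i, rfl⟩
    exact isHomogeneous_mem_pow_idealOfVars (hdeg i)
  have hne : (∏ i, f i) ^ t ≠ 0 := pow_ne_zero _ (Finset.prod_ne_zero_iff.2 fun i _ => hf i)
  have hhom : ((∏ i, f i) ^ t).IsHomogeneous ((∑ _i : Fin s, e) * t) :=
    (IsHomogeneous.prod _ _ _ fun i _ => hdeg i).pow t
  obtain ⟨v, hv⟩ := support_nonempty.2 hne
  have hlow := (mem_pow_idealOfVars_iff _ _).1 (hle hmem) v hv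
  have hdegv : Finsupp.degree v = (∑ _i : Fin s, e) * t := by
    rw [Finsupp.degree_eq_weight_one]
    exact hhom (mem_support_iff.1 hv)
  simp only [Finset.sum_const, Finset.card_univ, Fintype.card_fin, smul_eq_mul] at hdegv
  rw [hdegv] at hlow
  nlinarith

lemma SubsetsRegular.ne_zero_and_not_isUnit {A : Type*} [CommRing A] {s m : ℕ}
    {f : Fin s → A} (h : SubsetsRegular f m) (hm : 1 ≤ m) (i : Fin s) :
    f i ≠ 0 ∧ ¬ IsUnit (f i) := by
  have hi := h [i] (List.nodup_singleton i) (by simpa)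
  rw [List.map_singleton] at hi
  have hnontriv := hi.nontrivial
  have hreg := (RingTheory.Sequence.isWeaklyRegular_singleton_iff A (f i)).1 hi.toIsWeaklyRegular
  refine ⟨fun h0 => ?_, fun hu => ?_⟩
  · rw [h0] at hreg
    exact one_ne_zero (hreg (by simp : (0 : A) • (1 : A) = (0 : A) • (0 : A)))
  · refine hi.top_ne_smul ?_
    rw [smul_eq_mul, Ideal.mul_top, Ideal.ofList_singleton, Ideal.span_singleton_eq_top.2 hu]

end Graded

lemma prod_pow_notMem_configIdeal_pow {A : Type*} [CommRing A] {s c : ℕ} {f : Fin s → A}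
    (h : RegularOnSubsets f Finset.univ c) (hcs : c ≤ s) {t r : ℕ}
    (ht : (∏ i, f i) ^ t ∉ Ideal.span (Set.range f) ^ (s * t + 1)) (hr : s * t < (s - c + 1) * r) :
    (∏ i, f i) ^ t ∉ configIdeal c f ^ r := fun hmem => ht <|
  Ideal.pow_le_pow_right (Nat.succ_le_of_lt hr) <| by
    rw [pow_mul]
    exact Ideal.pow_right_mono (configIdeal_le_span_pow h hcs) r hmem

lemma sSup_resurgence_configIdeal {A : Type*} [CommRing A] [IsNoetherianRing A] {s c : ℕ}
    {f : Fin s → A} (h : RegularOnSubsets f Finset.univ c) (hc : 1 ≤ c) (hcs : c ≤ s)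
    (hprod : ∀ t, (∏ i, f i) ^ t ∉ Ideal.span (Set.range f) ^ (s * t + 1)) :
    sSup {x : ℝ | ∃ m r : ℕ, 0 < m ∧ 0 < r ∧
        ¬ (symbolicPower (configIdeal c f) m ≤ (configIdeal c f) ^ r) ∧ x = (m : ℝ) / r}
      = ((c * (s - c + 1) : ℕ) : ℝ) / (s : ℝ) := by
  have hs : (0 : ℝ) < s := by exact_mod_cast (by lia : 0 < s)
  have hmem : ∀ q : ℕ, 1 ≤ q → ((c * ((s - c + 1) * q) : ℕ) : ℝ) / ((s * q + 1 : ℕ) : ℝ) ∈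
      {x : ℝ | ∃ m r : ℕ, 0 < m ∧ 0 < r ∧
        ¬ (symbolicPower (configIdeal c f) m ≤ (configIdeal c f) ^ r) ∧ x = (m : ℝ) / r} := by
    intro q hq
    refine ⟨_, _, by positivity, by positivity, fun hle => ?_, rfl⟩
    refine prod_pow_notMem_configIdeal_pow h hcs (hprod ((s - c + 1) * q)) ?_
      (hle (prod_pow_mem_symbolicPower h ((s - c + 1) * q)))
    have : 0 < s - c + 1 := Nat.succ_pos _
    nlinarith
  refine csSup_eq_of_forall_le_of_forall_lt_exists_gt ⟨_, hmem 1 le_rfl⟩ ?_ ?_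
  · rintro _ ⟨m, r, -, hr, hnle, rfl⟩
    have hlt : m * s < r * (c * (s - c + 1)) := by
      by_contra! hge
      exact hnle (symbolicPower_configIdeal_le_pow h hc hcs hge)
    rw [div_le_div_iff₀ (by exact_mod_cast hr) hs]
    exact_mod_cast (hlt.le.trans_eq (mul_comm _ _))
  · intro w hw
    rw [lt_div_iff₀ hs] at hw
    obtain ⟨q, hq⟩ := exists_nat_gt (max 1 (w / (((c * (s - c + 1) : ℕ) : ℝ) - w * s)))
    have hq1 : (1 : ℝ) < q := (le_max_left _ _).trans_lt hq
    have hq2 := (le_max_right _ _).trans_lt hq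
    refine ⟨_, hmem q (by exact_mod_cast hq1.le), ?_⟩
    rw [div_lt_iff₀ (sub_pos.2 hw)] at hq2
    rw [lt_div_iff₀ (by positivity)]
    push_cast at hq2 ⊢
    linarith

theorem statement19 (k : Type) [Field k] [Infinite k] (n s c : ℕ)
    (hc1 : 1 ≤ c) (hcn : c ≤ n) (hcs : c ≤ s)
    (f : Fin s → MvPolynomial (Fin (n + 1)) k) (d : Fin s → ℕ)
    (hdeg : ∀ i, (f i).IsHomogeneous (d i))
    (hcase : RingTheory.Sequence.IsRegular (MvPolynomial (Fin (n + 1)) k) (List.ofFn f)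
      ∨ (SubsetsRegular f (c + 1) ∧ ∀ i j, d i = d j)) :
    sSup {x : ℝ | ∃ m r : ℕ, 0 < m ∧ 0 < r ∧
        ¬ (symbolicPower (configIdeal c f) m ≤ (configIdeal c f) ^ r) ∧ x = (m : ℝ) / r}
      = ((c * (s - c + 1) : ℕ) : ℝ) / (s : ℝ) := by
  rcases hcase with hreg | ⟨hreg, hd⟩
  · refine sSup_resurgence_configIdeal (regularOnSubsets_of_isRegular hdeg hreg c) hc1 hcs
      fun t => ?_
    have := (regularOnSubsets_of_isRegular hdeg hreg s).prod_pow_notMem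
      (span_range_ne_top_of_isRegular hreg) fun _ => t
    simpa [Finset.prod_pow] using this
  · have hne := hreg.ne_zero_and_not_isUnit (Nat.le_add_left 1 c)
    let i₀ : Fin s := ⟨0, by lia⟩
    refine sSup_resurgence_configIdeal hreg.regularOnSubsets hc1 hcs
      (prod_pow_notMem_of_isHomogeneous (e := d i₀) ?_ (fun i => hd i i₀ ▸ hdeg i)
        fun i => (hne i).1)
    by_contra! hlt
    have hdeg₀ := hdeg i₀
    rw [Nat.lt_one_iff.1 hlt, ← totalDegree_zero_iff_isHomogeneous,
      totalDegree_eq_zero_iff_eq_C] at hdeg₀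
    refine (hne i₀).2 (hdeg₀ ▸ (isUnit_iff_ne_zero.2 fun h0 => (hne i₀).1 ?_).map C)
    rw [hdeg₀, h0, C_0]
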